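/- arXiv:2201.07621 — 2 statements merged into one kernel-verified Lean document; each statement's English description precedes it below -/
import Mathlib

section
/- Let 0 < t < 1 and s > 0, and define h = √(s + t − st), a = (1−h)²/(1−t)², b = (1+h)²/(1−t)², and the Fisher limiting spectral density p_{s,t}(x) = (1−t)/(2π x (s + t x)) · √((b−x)(x−a)) for a ≤ x ≤ b. Then ∫_a^b (x/(x + s/t))² · p_{s,t}(x) dx = t²(s² + s + t)/(s + t)³. -/
open Real

/-- The linear arcsine primitive of `1 / √((q - u) (u - p))`. -/
lemma hasDerivAt_arcsin_linear {p q u : ℝ} (hpu : p < u) (huq : u < q) :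
    HasDerivAt (fun v => arcsin ((2 * v - (p + q)) / (q - p)))
      (1 / √((q - u) * (u - p))) u := by
  have hqp : 0 < q - p := by linarith
  have hR : 0 < (q - u) * (u - p) := mul_pos (by linarith) (by linarith)
  have hsq : 1 - ((2 * u - (p + q)) / (q - p)) ^ 2
      = (2 / (q - p)) ^ 2 * ((q - u) * (u - p)) := by
    field_simp
    ring
  have hlt : ((2 * u - (p + q)) / (q - p)) ^ 2 < 1 := by
    have : 0 < (2 / (q - p)) ^ 2 * ((q - u) * (u - p)) := by positivity
    linarith
  have habs := abs_lt.mp ((sq_lt_one_iff_abs_lt_one _).mp hlt)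
  have hin : HasDerivAt (fun v : ℝ => (2 * v - (p + q)) / (q - p)) (2 / (q - p)) u := by
    simpa using (((hasDerivAt_id u).const_mul 2).sub_const (p + q)).div_const (q - p)
  have h := (hasDerivAt_arcsin habs.1.ne' habs.2.ne).comp u hin
  rw [hsq, sqrt_mul (by positivity), sqrt_sq (by positivity)] at h
  refine h.congr_deriv ?_
  have := sqrt_pos.mpr hR
  field_simp

/-- The Möbius arcsine primitive of `√(p q) / (u √((q - u) (u - p)))`. -/
lemma hasDerivAt_arcsin_moebius {p q D u : ℝ} (hp : 0 < p) (hD : 0 < D) (hD2 : D ^ 2 = p * q)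
    (hpu : p < u) (huq : u < q) :
    HasDerivAt (fun v => arcsin (((p + q) * v - 2 * (p * q)) / ((q - p) * v)))
      (D / (u * √((q - u) * (u - p)))) u := by
  have hqp : 0 < q - p := by linarith
  have hu : 0 < u := by linarith
  have hR : 0 < (q - u) * (u - p) := mul_pos (by linarith) (by linarith)
  have hsq : 1 - (((p + q) * u - 2 * (p * q)) / ((q - p) * u)) ^ 2
      = (2 * D / ((q - p) * u)) ^ 2 * ((q - u) * (u - p)) := by
    rw [div_pow (2 * D), mul_pow 2 D, hD2]
    field_simp
    ring
  have hlt : (((p + q) * u - 2 * (p * q)) / ((q - p) * u)) ^ 2 < 1 := by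
    have : 0 < (2 * D / ((q - p) * u)) ^ 2 * ((q - u) * (u - p)) := by positivity
    linarith
  have habs := abs_lt.mp ((sq_lt_one_iff_abs_lt_one _).mp hlt)
  have hin : HasDerivAt (fun v : ℝ => ((p + q) * v - 2 * (p * q)) / ((q - p) * v))
      (2 * D ^ 2 / ((q - p) * u ^ 2)) u := by
    have hnum : HasDerivAt (fun v : ℝ => (p + q) * v - 2 * (p * q)) (p + q) u := by
      simpa using ((hasDerivAt_id u).const_mul (p + q)).sub_const (2 * (p * q))
    have hden : HasDerivAt (fun v : ℝ => (q - p) * v) (q - p) u := by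
      simpa using (hasDerivAt_id u).const_mul (q - p)
    refine (hnum.div hden (by positivity)).congr_deriv ?_
    rw [hD2]
    field_simp
    ring
  have h := (hasDerivAt_arcsin habs.1.ne' habs.2.ne).comp u hin
  rw [hsq, sqrt_mul (by positivity), sqrt_sq (by positivity)] at h
  refine h.congr_deriv ?_
  have := sqrt_pos.mpr hR
  field_simp

lemma integral_sub_mul_sqrt_div_cube {p q D : ℝ} (c : ℝ) (hp : 0 < p) (hpq : p < q)
    (hD : 0 < D) (hD2 : D ^ 2 = p * q) :
    ∫ u in p..q, (u - c) * √((q - u) * (u - p)) / u ^ 3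
      = π * (-1 + (p + q) / (2 * D) - c * (q - p) ^ 2 / (8 * D ^ 3)) := by
  have hqp : 0 < q - p := by linarith
  have hq : 0 < q := by linarith
  have hne : ∀ u ∈ Set.Icc p q, u ≠ 0 := fun u hu => (hp.trans_le hu.1).ne'
  have hcont : ContinuousOn (fun u => (u - c) * √((q - u) * (u - p)) / u ^ 3) (Set.Icc p q) :=
    ContinuousOn.div (by fun_prop) (by fun_prop) fun u hu => pow_ne_zero 3 (hne u hu)
  have hR : ContinuousOn (fun u => √((q - u) * (u - p))) (Set.Icc p q) := by fun_prop
  have hmoeb : ContinuousOn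
      (fun u => arcsin (((p + q) * u - 2 * (p * q)) / ((q - p) * u))) (Set.Icc p q) :=
    continuous_arcsin.comp_continuousOn <| ContinuousOn.div (by fun_prop) (by fun_prop)
      fun u hu => mul_ne_zero hqp.ne' (hne u hu)
  rw [intervalIntegral.integral_eq_sub_of_hasDerivAt_of_le hpq.le
    (f := fun u => -(√((q - u) * (u - p)) / u) - arcsin ((2 * u - (p + q)) / (q - p))
      - c * (-(1 / 2) * (√((q - u) * (u - p)) / u ^ 2)
        + (p + q) / (4 * (p * q)) * (√((q - u) * (u - p)) / u))
      + ((p + q) / (2 * D) - c * (q - p) ^ 2 / (8 * D ^ 3))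
        * arcsin (((p + q) * u - 2 * (p * q)) / ((q - p) * u)))]
  · have e1 : (2 * q - (p + q)) / (q - p) = 1 := by field_simp; ring
    have e2 : (2 * p - (p + q)) / (q - p) = -1 := by field_simp; ring
    have e3 : ((p + q) * q - 2 * (p * q)) / ((q - p) * q) = 1 := by field_simp; ring
    have e4 : ((p + q) * p - 2 * (p * q)) / ((q - p) * p) = -1 := by field_simp; ring
    simp only [e1, e2, e3, e4, sub_self, zero_mul, mul_zero, sqrt_zero, zero_div,
      arcsin_one, arcsin_neg_one]
    ring
  · have h1 := hR.div continuousOn_id hne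
    have h2 := hR.div (continuousOn_id.pow 2) fun u hu => pow_ne_zero 2 (hne u hu)
    have h3 : ContinuousOn (fun u => arcsin ((2 * u - (p + q)) / (q - p))) (Set.Icc p q) :=
      (continuous_arcsin.comp (by fun_prop)).continuousOn
    exact ((h1.neg.sub h3).sub (continuousOn_const.mul
      ((continuousOn_const.mul h2).add (continuousOn_const.mul h1)))).add
      (continuousOn_const.mul hmoeb)
  · intro u hu
    have hu0 : 0 < u := hp.trans hu.1
    have hpos : 0 < (q - u) * (u - p) :=
      mul_pos (sub_pos.mpr hu.2) (sub_pos.mpr hu.1)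
    have hr := sqrt_pos.mpr hpos
    have hr2 := sq_sqrt hpos.le
    have hquad : HasDerivAt (fun v : ℝ => (q - v) * (v - p)) (p + q - 2 * u) u :=
      (((hasDerivAt_id u).const_sub q).mul ((hasDerivAt_id u).sub_const p)).congr_deriv
        (by simp; ring)
    have hs := hquad.sqrt hpos.ne'
    have h1 := hs.div (hasDerivAt_id u) hu0.ne'
    have h2 := hs.div ((hasDerivAt_id u).pow 2) (pow_ne_zero 2 hu0.ne')
    have h3 := hasDerivAt_arcsin_linear hu.1 hu.2
    have h4 := hasDerivAt_arcsin_moebius hp hD hD2 hu.1 hu.2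
    refine (((h1.neg.sub h3).sub (((h2.const_mul (-(1 / 2))).add
      (h1.const_mul ((p + q) / (4 * (p * q))))).const_mul c)).add
      (h4.const_mul ((p + q) / (2 * D) - c * (q - p) ^ 2 / (8 * D ^ 3)))).congr_deriv ?_
    have hlast : ((p + q) / (2 * D) - c * (q - p) ^ 2 / (8 * D ^ 3))
          * (D / (u * √((q - u) * (u - p))))
        = ((p + q) / 2 - c * (q - p) ^ 2 / (8 * (p * q))) / (u * √((q - u) * (u - p))) := by
      rw [← hD2]
      field_simp
    rw [hlast]
    generalize √((q - u) * (u - p)) = r at hr hr2 ⊢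
    simp only [Pi.pow_apply, id]
    field_simp
    ring_nf
    simp only [hr2]
    ring
  · exact hcont.intervalIntegrable_of_Icc hpq.le


/-- Second moment identity for the Fisher limiting spectral distribution:
`∫_a^b (x/(x+s/t))² p_{s,t}(x) dx = t²(s²+s+t)/(s+t)³`. -/
theorem fisher_I_two (s t : ℝ) (hs : 0 < s) (ht0 : 0 < t) (ht1 : t < 1) :
    let h := Real.sqrt (s + t - s * t)
    let a := (1 - h) ^ 2 / (1 - t) ^ 2
    let b := (1 + h) ^ 2 / (1 - t) ^ 2
    (∫ x in a..b,
        (x / (x + s / t)) ^ 2 *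
          ((1 - t) / (2 * Real.pi * x * (s + t * x)) *
            Real.sqrt ((b - x) * (x - a)))) =
      t ^ 2 * (s ^ 2 + s + t) / (s + t) ^ 3 := by
  intro h a b
  have ht : 0 < 1 - t := by linarith
  have hpos : 0 < s + t - s * t := by nlinarith
  have hh : 0 < h := sqrt_pos.mpr hpos
  have hh2 : h ^ 2 = s + t - s * t := sq_sqrt hpos.le
  have hst : 0 < s / t := by positivity
  have ha : 0 ≤ a := by positivity
  have hba : b - a = 4 * h / (1 - t) ^ 2 := by
    simp only [a, b]
    ring
  have hab : a < b := by
    have : 0 < 4 * h / (1 - t) ^ 2 := by positivity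
    linarith
  have hsum : a + b = 2 * (1 + h ^ 2) / (1 - t) ^ 2 := by
    simp only [a, b]
    ring
  have hprod : a * b = (1 - s) ^ 2 / (1 - t) ^ 2 := by
    have : a * b = (1 - h ^ 2) ^ 2 / (1 - t) ^ 4 := by
      simp only [a, b]
      field_simp
      ring
    rw [this, hh2]
    field_simp
    ring
  have hD2 : ((s + t) / (t * (1 - t))) ^ 2 = (a + s / t) * (b + s / t) := by
    have : (a + s / t) * (b + s / t) = a * b + s / t * (a + b) + (s / t) ^ 2 := by ring
    rw [this, hsum, hprod, hh2]
    field_simp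
    ring
  have key := integral_sub_mul_sqrt_div_cube (s / t) (by linarith : 0 < a + s / t)
    (by linarith : a + s / t < b + s / t) (by positivity : 0 < (s + t) / (t * (1 - t))) hD2
  rw [← intervalIntegral.integral_comp_add_right] at key
  have hint : ∀ x ∈ Set.uIcc a b, (x / (x + s / t)) ^ 2 *
        ((1 - t) / (2 * π * x * (s + t * x)) * √((b - x) * (x - a)))
      = (1 - t) / (2 * π * t) * ((x + s / t - s / t)
        * √((b + s / t - (x + s / t)) * (x + s / t - (a + s / t))) / (x + s / t) ^ 3) := by
    intro x hx
    rw [Set.uIcc_of_le hab.le] at hx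
    have hx0 : 0 ≤ x := ha.trans hx.1
    have hxs : 0 < x + s / t := by linarith
    have hlin : s + t * x = t * (x + s / t) := by
      field_simp
      ring
    rw [hlin, add_sub_cancel_right, add_sub_add_right_eq_sub, add_sub_add_right_eq_sub]
    generalize x + s / t = y at hxs
    rcases hx0.eq_or_lt with rfl | hx0
    · simp
    · have := pi_pos
      field_simp
  rw [intervalIntegral.integral_congr hint, intervalIntegral.integral_const_mul, key]
  have e1 : a + s / t + (b + s / t) = 2 * (1 + h ^ 2) / (1 - t) ^ 2 + 2 * (s / t) := by
    rw [← hsum]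
    ring
  have e2 : (b + s / t - (a + s / t)) ^ 2 = 16 * h ^ 2 / (1 - t) ^ 4 := by
    rw [add_sub_add_right_eq_sub, hba]
    field_simp
    ring
  rw [e1, e2, hh2]
  have := pi_pos
  field_simp
  ring
end

section
/- Let k ≥ 1 be an integer and 0 < t < 1, and set for s = 1 (so h = 1): I_k(t) = ∫_0^b (x/(x + 1/t))^k · p_{1,t}(x) dx, where b = 4/(1−t)² and p_{1,t}(x) = (1−t)√((b−x)x)/(2π x (1 + t x)) on (0, b]. Then I_k(t) = −(1−t)/(2t) − (1/(2t)) · Σ_{j_1+j_2+j_3+j_4=k} (−1)^{j_4 − j_2 + 1} · binom(2k, j_1) · binom(2, j_2) · ((k+j_4)!/(k! j_4!)) · (1−t)^{k−j_1−j_4} · (1+t)^{1−j_2−k−j_4} · t^{k+j_4−j_3}, the sum ranging over all quadruples of nonnegative integers with j_1 + j_2 + j_3 + j_4 = k. -/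
open Real Finset

theorem circleIntegral_polynomial_div_sub_pow (P : Polynomial ℂ) {c w : ℂ} {R : ℝ}
    (hw : w ∈ Metric.ball c R) (m : ℕ) :
    (∮ z in C(c, R), P.eval (z - w) / (z - w) ^ (m + 1)) = 2 * π * Complex.I * P.coeff m := by
  have hR : 0 < R := Metric.pos_of_mem_ball hw
  have hne : ∀ z ∈ Metric.sphere c R, z - w ≠ 0 := by
    intro z hz h
    rw [sub_eq_zero.1 h, Metric.mem_sphere] at hz
    exact absurd hz (Metric.mem_ball.1 hw).ne
  induction P using Polynomial.induction_on' with
  | add p q hp hq =>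
    have h_integrable : ∀ p : Polynomial ℂ,
        CircleIntegrable (fun z => p.eval (z - w) / (z - w) ^ (m + 1)) c R := by
      intro p
      refine ContinuousOn.circleIntegrable hR.le (ContinuousOn.div ?_ (by fun_prop) ?_)
      · exact (p.continuous.comp (continuous_id.sub continuous_const)).continuousOn
      · exact fun z hz => pow_ne_zero _ (hne z hz)
    simp only [Polynomial.eval_add, add_div, Polynomial.coeff_add, mul_add]
    rw [circleIntegral.integral_add (h_integrable p) (h_integrable q), hp, hq]
  | monomial n a =>
    have hcongr : (∮ z in C(c, R), (Polynomial.monomial n a).eval (z - w) / (z - w) ^ (m + 1)) =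
        ∮ z in C(c, R), a * (z - w) ^ ((n : ℤ) - (m + 1 : ℕ)) := by
      refine circleIntegral.integral_congr hR.le fun z hz => ?_
      simp only [Polynomial.eval_monomial]
      rw [zpow_sub₀ (hne z hz), zpow_natCast, zpow_natCast, mul_div_assoc]
    rw [hcongr, circleIntegral.integral_const_mul, Polynomial.coeff_monomial]
    split_ifs with h
    · subst h
      simp only [Nat.cast_add, Nat.cast_one, sub_add_cancel_left, zpow_neg_one]
      rw [circleIntegral.integral_sub_inv_of_mem_ball hw]
      ring
    · rw [circleIntegral.integral_sub_zpow_of_ne (by push_cast; omega)]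
      simp

/-- The residue theorem on the unit circle for `N (z - w) / (z (z - w) ^ (m + 1) B (z - w))`, where
`S` is the power series of `N / ((X + w) B)`, i.e. the expansion around the pole `w`. -/
theorem circleIntegral_eq_residue_add_residue (N B : Polynomial ℂ) (S : PowerSeries ℂ) {w : ℂ}
    (m : ℕ)
    (hw0 : w ≠ 0) (hw : w ∈ Metric.ball (0 : ℂ) 1)
    (hB : ∀ z ∈ Metric.closedBall (0 : ℂ) 1, B.eval (z - w) ≠ 0)
    (hS : ((Polynomial.X + Polynomial.C w : Polynomial ℂ) : PowerSeries ℂ) * (B : PowerSeries ℂ) * S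
      = N) :
    (∮ z in C(0, 1), N.eval (z - w) / (z * (z - w) ^ (m + 1) * B.eval (z - w))) =
      2 * π * Complex.I * (S.coeff m + N.eval (-w) / ((-w) ^ (m + 1) * B.eval (-w))) := by
  have hne : ∀ z ∈ Metric.sphere (0 : ℂ) 1, z - w ≠ 0 := by
    intro z hz h
    rw [sub_eq_zero.1 h, Metric.mem_sphere] at hz
    exact absurd hz (Metric.mem_ball.1 hw).ne
  set P := PowerSeries.trunc (m + 1) S with hP
  obtain ⟨R, hR⟩ : (Polynomial.X : Polynomial ℂ) ^ (m + 1) ∣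
      N - (Polynomial.X + Polynomial.C w) * B * P := by
    rw [Polynomial.X_pow_dvd_iff]
    intro d hd
    rw [Polynomial.coeff_sub, sub_eq_zero, ← Polynomial.coeff_coe, ← Polynomial.coeff_coe, ← hS,
      ← Polynomial.coe_mul, PowerSeries.coeff_mul_eq_coeff_trunc_mul_trunc _ S hd,
      Polynomial.coe_mul _ P,
      PowerSeries.coeff_mul_eq_coeff_trunc_mul_trunc
        (((Polynomial.X + Polynomial.C w) * B : Polynomial ℂ) : PowerSeries ℂ) P hd,
      hP, PowerSeries.trunc_trunc]
  have heval : ∀ x, N.eval x = (x + w) * B.eval x * P.eval x + x ^ (m + 1) * R.eval x := by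
    intro x
    have := congrArg (Polynomial.eval x) hR
    simp only [Polynomial.eval_sub, Polynomial.eval_mul, Polynomial.eval_add, Polynomial.eval_X,
      Polynomial.eval_C, Polynomial.eval_pow] at this
    linear_combination this
  have hB' : ∀ z ∈ Metric.sphere (0 : ℂ) 1, B.eval (z - w) ≠ 0 :=
    fun z hz => hB z (Metric.sphere_subset_closedBall hz)
  have hz0 : ∀ z ∈ Metric.sphere (0 : ℂ) 1, z ≠ 0 := fun z hz => by
    rintro rfl; simp at hz
  have hcont : ∀ p : Polynomial ℂ, Continuous fun z => p.eval (z - w) := fun p =>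
    p.continuous.comp (continuous_id.sub continuous_const)
  have hdiff : ∀ p : Polynomial ℂ, Differentiable ℂ fun z => p.eval (z - w) := fun p =>
    p.differentiable.comp (differentiable_id.sub_const w)
  have hcongr : (∮ z in C(0, 1), N.eval (z - w) / (z * (z - w) ^ (m + 1) * B.eval (z - w))) =
      ∮ z in C(0, 1), (P.eval (z - w) / (z - w) ^ (m + 1) +
        (R.eval (z - w) / B.eval (z - w)) / (z - 0)) := by
    refine circleIntegral.integral_congr zero_le_one fun z hz => ?_
    have h1 := hne z hz
    have h2 := hB' z hz
    have h3 := hz0 z hz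
    simp only [heval (z - w), sub_zero]
    field_simp
    ring
  rw [hcongr, circleIntegral.integral_add, circleIntegral_polynomial_div_sub_pow P hw,
    Complex.circleIntegral_div_sub_of_differentiable_on_off_countable Set.countable_empty
      (Metric.mem_ball_self one_pos)]
  · have hR0 : N.eval (-w) = (-w) ^ (m + 1) * R.eval (-w) := by rw [heval]; ring
    have : P.coeff m = S.coeff m := by simp [hP, PowerSeries.coeff_trunc]
    rw [this, hR0, zero_sub, mul_div_mul_left _ _ (pow_ne_zero _ (neg_ne_zero.2 hw0))]
    ring
  · exact (hcont R).continuousOn.div (hcont B).continuousOn hB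
  · intro z hz
    exact (hdiff R z).div (hdiff B z) (hB z (Metric.ball_subset_closedBall hz.1))
  · exact ((hcont P).continuousOn.div (by fun_prop)
      fun z hz => pow_ne_zero _ (hne z hz)).circleIntegrable zero_le_one
  · exact (((hcont R).continuousOn.div (hcont B).continuousOn hB').div (by fun_prop)
      fun z hz => by simpa using hz0 z hz).circleIntegrable zero_le_one

theorem PowerSeries.coeff_prod_univ_fin {R : Type*} [CommSemiring R] {m : ℕ}
    (f : Fin m → PowerSeries R) (n : ℕ) :
    PowerSeries.coeff n (∏ i, f i) =
      ∑ j ∈ Finset.Nat.antidiagonalTuple m n, ∏ i, PowerSeries.coeff (j i) (f i) := by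
  rw [PowerSeries.coeff_prod]
  refine Finset.sum_nbij' (fun l => ⇑l) Finsupp.equivFunOnFinite.symm ?_ ?_ ?_ ?_ ?_
  · intro l hl
    simp only [Finset.mem_finsuppAntidiag] at hl
    simpa [Finset.Nat.mem_antidiagonalTuple] using hl.1
  · intro j hj
    simpa [Finset.mem_finsuppAntidiag, Finset.Nat.mem_antidiagonalTuple] using hj
  · intro l _
    simp
  · intro j _
    simp
  · intro l _
    rfl

theorem PowerSeries.X_sub_C_mul_mk_neg_inv_pow {K : Type*} [Field K] {a : K} (ha : a ≠ 0) :
    (PowerSeries.X - PowerSeries.C a) * PowerSeries.mk (fun n => -(a ^ (n + 1))⁻¹) = 1 := by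
  ext n
  cases n with
  | zero => simp [sub_mul, ha]
  | succ n =>
    simp only [sub_mul, map_sub, PowerSeries.coeff_succ_X_mul, PowerSeries.coeff_mk,
      PowerSeries.coeff_C_mul, PowerSeries.coeff_one]
    simp
    field_simp
    ring

theorem PowerSeries.add_C_mul_X_pow_mul_mk {K : Type*} [Field K] {a : K} (b : K) (ha : a ≠ 0)
    (k : ℕ) :
    (PowerSeries.C a + PowerSeries.C b * PowerSeries.X) ^ (k + 1) *
      PowerSeries.mk (fun n => ((k + n).choose k : K) * (-b) ^ n / a ^ (k + 1 + n)) = 1 := by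
  have hmk : PowerSeries.mk (fun n => ((k + n).choose k : K) * (-b) ^ n / a ^ (k + 1 + n)) =
      PowerSeries.C ((a ^ (k + 1))⁻¹) *
        PowerSeries.rescale (-b / a) (PowerSeries.mk fun n => ((k + n).choose k : K)) := by
    ext n
    simp only [PowerSeries.coeff_mk, PowerSeries.coeff_C_mul, PowerSeries.coeff_rescale]
    rw [div_pow, pow_add a]
    field_simp
  have hlin : PowerSeries.C a + PowerSeries.C b * PowerSeries.X =
      PowerSeries.C a * PowerSeries.rescale (-b / a) (1 - PowerSeries.X) := by
    rw [map_sub, PowerSeries.rescale_X, map_one, mul_sub, ← mul_assoc, ← map_mul,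
      mul_div_cancel₀ _ ha, map_neg]
    ring
  have h := congrArg (PowerSeries.rescale (-b / a))
    (PowerSeries.mk_add_choose_mul_one_sub_pow_eq_one K k)
  rw [map_mul, map_pow, map_one] at h
  have hC : PowerSeries.C a ^ (k + 1) * PowerSeries.C ((a ^ (k + 1))⁻¹) = 1 := by
    rw [← map_pow, ← map_mul, mul_inv_cancel₀ (pow_ne_zero _ ha), map_one]
  rw [hmk, hlin, mul_pow]
  linear_combination hC + PowerSeries.C a ^ (k + 1) * PowerSeries.C ((a ^ (k + 1))⁻¹) * h

/-- The power series in `z + t` of `(1 + z) ^ (2 * k)`, `(1 - z) ^ 2`, `z⁻¹` and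
`((1 + t * z) ^ (k + 1))⁻¹`. -/
noncomputable def fisherFactors (k : ℕ) (t : ℂ) : Fin 4 → PowerSeries ℂ :=
  ![(((Polynomial.X + Polynomial.C (1 - t)) ^ (2 * k) : Polynomial ℂ) : PowerSeries ℂ),
    (((Polynomial.X + Polynomial.C (-(1 + t))) ^ 2 : Polynomial ℂ) : PowerSeries ℂ),
    PowerSeries.mk (fun n => -(t ^ (n + 1))⁻¹),
    PowerSeries.mk (fun n => ((k + n).choose k : ℂ) * (-t) ^ n / (1 - t ^ 2) ^ (k + 1 + n))]

theorem prod_fisherFactors (k : ℕ) {t : ℂ} (ht : t ≠ 0) (ht' : 1 - t ^ 2 ≠ 0) :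
    ((Polynomial.X + Polynomial.C (-t) : Polynomial ℂ) : PowerSeries ℂ) *
      (((Polynomial.C (1 - t ^ 2) + Polynomial.C t * Polynomial.X) ^ (k + 1) : Polynomial ℂ) :
        PowerSeries ℂ) * ∏ i, fisherFactors k t i =
      (((Polynomial.X + Polynomial.C (1 - t)) ^ (2 * k) *
        (Polynomial.X + Polynomial.C (-(1 + t))) ^ 2 : Polynomial ℂ) : PowerSeries ℂ) := by
  have h3 := PowerSeries.X_sub_C_mul_mk_neg_inv_pow ht
  have h4 := PowerSeries.add_C_mul_X_pow_mul_mk t ht' k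
  simp only [fisherFactors, Fin.prod_univ_four, Matrix.cons_val, Polynomial.coe_mul,
    Polynomial.coe_pow, Polynomial.coe_add, Polynomial.coe_X, Polynomial.coe_C]
  simp only [map_neg]
  set F3 := PowerSeries.mk (fun n => -(t ^ (n + 1))⁻¹)
  set F4 := PowerSeries.mk
    (fun n => ((k + n).choose k : ℂ) * (-t) ^ n / (1 - t ^ 2) ^ (k + 1 + n))
  rw [← sub_eq_add_neg]
  set G3 := PowerSeries.X - PowerSeries.C t
  set G4 := (PowerSeries.C (1 - t ^ 2) + PowerSeries.C t * PowerSeries.X) ^ (k + 1)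
  set A := (PowerSeries.X + PowerSeries.C (1 - t)) ^ (2 * k)
  set B := (PowerSeries.X + -PowerSeries.C (1 + t)) ^ 2
  linear_combination A * B * G4 * F4 * h3 + A * B * h4

theorem coeff_prod_fisherFactors (k : ℕ) {t : ℂ} (ht : t ≠ 0) (ht1 : 1 - t ≠ 0)
    (ht2 : 1 + t ≠ 0) :
    (1 - t) * t ^ (k + 1) * PowerSeries.coeff k (∏ i, fisherFactors k t i) =
      ∑ j ∈ Finset.Nat.antidiagonalTuple 4 k,
            (-1 : ℂ) ^ ((j 3 : ℤ) - (j 1 : ℤ) + 1) *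
              (Nat.choose (2 * k) (j 0) : ℂ) * (Nat.choose 2 (j 1) : ℂ) *
              ((Nat.factorial (k + j 3) : ℂ) /
                ((Nat.factorial k : ℂ) * (Nat.factorial (j 3) : ℂ))) *
              (1 - t) ^ ((k : ℤ) - (j 0 : ℤ) - (j 3 : ℤ)) *
              (1 + t) ^ ((1 : ℤ) - (j 1 : ℤ) - (k : ℤ) - (j 3 : ℤ)) *
              t ^ ((k : ℤ) + (j 3 : ℤ) - (j 2 : ℤ)) := by
  rw [PowerSeries.coeff_prod_univ_fin, Finset.mul_sum]
  refine Finset.sum_congr rfl fun j hj => ?_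
  have hj0 : j 0 ≤ 2 * k := by
    rw [Finset.Nat.mem_antidiagonalTuple, Fin.sum_univ_four] at hj
    omega
  have hchoose : ((k + j 3).choose k : ℂ) =
      (Nat.factorial (k + j 3) : ℂ) / ((Nat.factorial k : ℂ) * (Nat.factorial (j 3) : ℂ)) := by
    rw [Nat.cast_add_choose]
  simp only [fisherFactors, Fin.prod_univ_four, Matrix.cons_val, PowerSeries.coeff_mk,
    Polynomial.coeff_coe, Polynomial.coeff_X_add_C_pow, hchoose]
  rcases lt_or_ge 2 (j 1) with h | h
  · simp [Nat.choose_eq_zero_of_lt h]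
  have hsq : 1 - t ^ 2 = (1 - t) * (1 + t) := by ring
  have hs : (-1 : ℂ) ^ ((j 3 : ℤ) - (j 1 : ℤ) + 1) = -((-1) ^ (j 3) * (-1) ^ (2 - j 1)) := by
    rw [show (j 3 : ℤ) - j 1 + 1 = (j 3 : ℤ) + (2 - j 1 : ℕ) - 1 by omega,
      zpow_sub₀ (by norm_num), zpow_add₀ (by norm_num), zpow_natCast, zpow_natCast]
    rw [zpow_one, div_neg, div_one]
  have h1 : (1 - t) ^ ((k : ℤ) - (j 0 : ℤ) - (j 3 : ℤ)) =
      (1 - t) * (1 - t) ^ (2 * k - j 0) / (1 - t) ^ (k + 1 + j 3) := by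
    rw [← pow_succ', ← zpow_natCast, ← zpow_natCast, ← zpow_sub₀ ht1]
    congr 1
    omega
  have h2 : (1 + t) ^ ((1 : ℤ) - (j 1 : ℤ) - (k : ℤ) - (j 3 : ℤ)) =
      (1 + t) ^ (2 - j 1) / (1 + t) ^ (k + 1 + j 3) := by
    rw [← zpow_natCast, ← zpow_natCast, ← zpow_sub₀ ht2]
    congr 1
    omega
  have h3 : t ^ ((k : ℤ) + (j 3 : ℤ) - (j 2 : ℤ)) = t ^ (k + 1) * t ^ j 3 / t ^ (j 2 + 1) := by
    rw [← pow_add, ← zpow_natCast, ← zpow_natCast, ← zpow_sub₀ ht]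
    congr 1
    omega
  rw [hs, h1, h2, h3, hsq, mul_pow _ _ (k + 1 + j 3), neg_pow t, neg_pow (1 + t)]
  generalize 1 - t = u
  generalize 1 + t = v
  ring

/-- The density, up to the factor `π⁻¹`, of the integral under `x = (2 + 2 cos θ) / (1 - t) ^ 2`. -/
noncomputable def fisherAngularDensity (k : ℕ) (t θ : ℝ) : ℝ :=
  (1 - t) * (1 - cos θ) / (1 + t ^ 2 + 2 * t * cos θ) *
    (t * (2 + 2 * cos θ) / (1 + t ^ 2 + 2 * t * cos θ)) ^ k

theorem one_add_sq_add_two_mul_cos_pos {t : ℝ} (ht0 : 0 < t) (ht1 : t < 1) (θ : ℝ) :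
    0 < 1 + t ^ 2 + 2 * t * cos θ := by
  nlinarith [neg_one_le_cos θ, mul_nonneg ht0.le (by linarith [neg_one_le_cos θ] : 0 ≤ 1 + cos θ),
    sq_pos_of_pos (sub_pos.2 ht1)]

theorem continuous_fisherAngularDensity (k : ℕ) {t : ℝ} (ht0 : 0 < t) (ht1 : t < 1) :
    Continuous (fisherAngularDensity k t) := by
  have h : ∀ θ, 1 + t ^ 2 + 2 * t * cos θ ≠ 0 :=
    fun θ => (one_add_sq_add_two_mul_cos_pos ht0 ht1 θ).ne'
  unfold fisherAngularDensity
  fun_prop (disch := exact h)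

theorem integral_fisherAngularDensity_eq_two_mul (k : ℕ) {t : ℝ} (ht0 : 0 < t) (ht1 : t < 1) :
    ∫ θ in (0 : ℝ)..(2 * π), fisherAngularDensity k t θ =
      2 * ∫ θ in (0 : ℝ)..π, fisherAngularDensity k t θ := by
  have hc := continuous_fisherAngularDensity k ht0 ht1
  have hsymm : ∫ θ in π..(2 * π), fisherAngularDensity k t θ =
      ∫ θ in (0 : ℝ)..π, fisherAngularDensity k t θ := by
    have h := intervalIntegral.integral_comp_sub_left (a := 0) (b := π)
      (fisherAngularDensity k t) (2 * π)
    rw [sub_zero, two_mul, add_sub_cancel_right, ← two_mul] at h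
    rw [← h]
    simp only [fisherAngularDensity, cos_two_pi_sub]
  rw [← intervalIntegral.integral_add_adjacent_intervals (b := π)
    (hc.intervalIntegrable _ _) (hc.intervalIntegrable _ _), hsymm, two_mul]

theorem integral_fisher_eq_integral_angular {k : ℕ} (hk : 1 ≤ k) {t : ℝ}
    (ht0 : 0 < t) (ht1 : t < 1) :
    (∫ x in (0:ℝ)..(4 / (1 - t) ^ 2),
        (x / (x + 1 / t)) ^ k *
          ((1 - t) * Real.sqrt ((4 / (1 - t) ^ 2 - x) * x) /
            (2 * Real.pi * x * (1 + t * x)))) =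
      π⁻¹ * ∫ θ in (0 : ℝ)..π, fisherAngularDensity k t θ := by
  obtain ⟨m, rfl⟩ : ∃ m, k = m + 1 := ⟨k - 1, by omega⟩
  have hu : 1 - t ≠ 0 := (sub_pos.2 ht1).ne'
  have hb : 0 < 4 / (1 - t) ^ 2 := by positivity
  set G : ℝ → ℝ := fun x => x ^ m / (x + 1 / t) ^ (m + 1) *
    ((1 - t) * Real.sqrt ((4 / (1 - t) ^ 2 - x) * x) / (2 * π * (1 + t * x))) with hG
  set f : ℝ → ℝ := fun θ => (2 + 2 * cos θ) / (1 - t) ^ 2 with hf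
  have hf0 : f 0 = 4 / (1 - t) ^ 2 := by simp [hf]; norm_num
  have hfpi : f π = 0 := by simp [hf]
  have hfnonneg : ∀ θ, 0 ≤ f θ := fun θ =>
    div_nonneg (by linarith [neg_one_le_cos θ]) (sq_nonneg _)
  have hGcont : ContinuousOn G (Set.Ici 0) := by
    refine ContinuousOn.mul (ContinuousOn.div (by fun_prop) (by fun_prop) fun x hx => ?_)
      (ContinuousOn.div (by fun_prop) (by fun_prop) fun x hx => ?_)
    all_goals
      have hx' : 0 ≤ x := hx
      positivity
  have hfG : ∫ x in (0:ℝ)..(4 / (1 - t) ^ 2), (x / (x + 1 / t)) ^ (m + 1) *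
      ((1 - t) * Real.sqrt ((4 / (1 - t) ^ 2 - x) * x) / (2 * π * x * (1 + t * x))) =
        ∫ x in f π..f 0, G x := by
    rw [hf0, hfpi]
    refine intervalIntegral.integral_congr fun x hx => ?_
    rw [Set.uIcc_of_le hb.le] at hx
    have hx0 : 0 ≤ x := hx.1
    rcases hx0.eq_or_lt with rfl | hx0
    · simp [hG]
    · simp only [hG, div_pow, pow_succ x m]
      have : 1 + t * x ≠ 0 := by positivity
      have : x + 1 / t ≠ 0 := by positivity
      field_simp
  have hsub := intervalIntegral.integral_comp_mul_deriv' (a := π) (b := 0) (f := f)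
    (f' := fun θ => 2 * -sin θ / (1 - t) ^ 2) (g := G)
    (fun θ _ => (((hasDerivAt_cos θ).const_mul 2).const_add 2).div_const _)
    (by fun_prop) (hGcont.mono (by rintro _ ⟨θ, -, rfl⟩; exact hfnonneg θ))
  rw [hfG, ← hsub, intervalIntegral.integral_symm, ← intervalIntegral.integral_neg,
    ← intervalIntegral.integral_const_mul]
  refine intervalIntegral.integral_congr fun θ hθ => ?_
  rw [Set.uIcc_of_le pi_pos.le] at hθ
  have hs : 0 ≤ sin θ := sin_nonneg_of_mem_Icc hθ
  have hsq : sin θ ^ 2 = 1 - cos θ ^ 2 := sin_sq θ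
  have hE := one_add_sq_add_two_mul_cos_pos ht0 ht1 θ
  have hsqrt : Real.sqrt ((4 / (1 - t) ^ 2 - f θ) * f θ) = 2 * sin θ / (1 - t) ^ 2 := by
    have : (4 / (1 - t) ^ 2 - f θ) * f θ = (2 * sin θ / (1 - t) ^ 2) ^ 2 := by
      rw [div_pow, mul_pow, hsq]
      simp only [hf]
      field_simp
      ring
    rw [this, Real.sqrt_sq (by positivity)]
  have hden : 1 + t * f θ = (1 + t ^ 2 + 2 * t * cos θ) / (1 - t) ^ 2 := by
    simp only [hf]
    field_simp
    ring
  have hratio : f θ / (f θ + 1 / t) = t * (2 + 2 * cos θ) / (1 + t ^ 2 + 2 * t * cos θ) := by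
    have : f θ + 1 / t = (1 + t * f θ) / t := by field_simp; ring
    rw [this, hden]
    simp only [hf]
    field_simp
  have hxs : sin θ ^ 2 = (1 - cos θ) * (f θ * (1 - t) ^ 2 / 2) := by
    rw [hsq]
    simp only [hf]
    field_simp
    ring
  simp only [Function.comp_apply, hG, fisherAngularDensity, hsqrt, hden]
  rw [← hratio, div_pow (f θ) (f θ + 1 / t), pow_succ (f θ) m]
  have hcalc : ∀ p q : ℝ, -(p / q * ((1 - t) * (2 * sin θ / (1 - t) ^ 2) /
        (2 * π * ((1 + t ^ 2 + 2 * t * cos θ) / (1 - t) ^ 2))) * (2 * -sin θ / (1 - t) ^ 2)) =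
      p / q * (2 * (1 - t) * sin θ ^ 2) / (π * (1 + t ^ 2 + 2 * t * cos θ) * (1 - t) ^ 2) := by
    intro p q
    field_simp
  rw [hcalc, hxs]
  field_simp

theorem integral_fisherAngularDensity_eq_circleIntegral (k : ℕ) {t : ℝ}
    (ht0 : 0 < t) (ht1 : t < 1) :
    ((∫ θ in (0 : ℝ)..(2 * π), fisherAngularDensity k t θ : ℝ) : ℂ) =
      (1 - t) * t ^ k * (Complex.I / 2) *
        ∮ z in C(0, 1), ((z + 1) ^ (2 * k) * (z - 1) ^ 2) /
          (z * (z + t) ^ (k + 1) * (1 + t * z) ^ (k + 1)) := by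
  rw [← intervalIntegral.integral_ofReal, circleIntegral, ← intervalIntegral.integral_const_mul]
  refine intervalIntegral.integral_congr fun θ _ => ?_
  have hE : ((1 + t ^ 2 + 2 * t * cos θ : ℝ) : ℂ) ≠ 0 :=
    Complex.ofReal_ne_zero.2 (one_add_sq_add_two_mul_cos_pos ht0 ht1 θ).ne'
  set z := circleMap 0 1 θ with hz
  have hzexp : z = Complex.exp (θ * Complex.I) := by simp [hz, circleMap]
  have hz0 : z ≠ 0 := by rw [hzexp]; exact Complex.exp_ne_zero _
  have hcos : (cos θ : ℂ) = (z + z⁻¹) / 2 := by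
    rw [hzexp, ← Complex.exp_neg, Complex.ofReal_cos, Complex.cos, neg_mul]
  have hE' : (1 + t ^ 2 + 2 * t * (cos θ : ℂ)) = (z + t) * (1 + t * z) / z := by
    rw [hcos]
    field_simp
    ring
  have h1 : 1 - (cos θ : ℂ) = -(z - 1) ^ 2 / (2 * z) := by
    rw [hcos]
    field_simp
    ring
  have h2 : 2 + 2 * (cos θ : ℂ) = (z + 1) ^ 2 / z := by
    rw [hcos]
    field_simp
    ring
  push_cast at hE
  rw [← Complex.ofReal_cos, hE'] at hE
  have hA : z + t ≠ 0 := fun h => hE (by rw [h]; simp)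
  have hB : 1 + t * z ≠ 0 := fun h => hE (by rw [h]; simp)
  simp only [fisherAngularDensity, deriv_circleMap, ← hz, smul_eq_mul]
  push_cast
  rw [← Complex.ofReal_cos, hE', h1, h2]
  simp only [div_pow, mul_pow, pow_mul]
  field_simp
  simp only [Complex.I_sq]
  ring

theorem circleIntegral_fisher (k : ℕ) {t : ℝ} (ht0 : 0 < t) (ht1 : t < 1) :
    (∮ z in C(0, 1), ((z + 1) ^ (2 * k) * (z - 1) ^ 2) /
        (z * (z + t) ^ (k + 1) * (1 + t * z) ^ (k + 1))) =
      2 * π * Complex.I *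
        (PowerSeries.coeff k (∏ i, fisherFactors k t i) + 1 / (t : ℂ) ^ (k + 1)) := by
  have ht : (t : ℂ) ≠ 0 := Complex.ofReal_ne_zero.2 ht0.ne'
  have ht' : 1 - (t : ℂ) ^ 2 ≠ 0 := by
    have : (1 - t ^ 2 : ℝ) ≠ 0 := by nlinarith
    exact_mod_cast this
  have hB : ∀ z : ℂ, (1 - (t : ℂ) ^ 2) + t * (z + t) = 1 + t * z := fun z => by ring
  have h := circleIntegral_eq_residue_add_residue _ _ _ (w := -(t : ℂ)) k (neg_ne_zero.2 ht)
    (by simpa [abs_of_pos ht0] using ht1) (fun z hz => ?_) (prod_fisherFactors k ht ht')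
  · simp only [Polynomial.eval_mul, Polynomial.eval_pow, Polynomial.eval_add, Polynomial.eval_X,
      Polynomial.eval_C, sub_neg_eq_add, hB, neg_neg] at h
    have h1 : ∀ z : ℂ, z + t + (1 - t) = z + 1 := fun z => by ring
    have h2 : ∀ z : ℂ, z + t + -(1 + t) = z - 1 := fun z => by ring
    have h3 : (t : ℂ) + (1 - t) = 1 := by ring
    have h4 : (t : ℂ) + -(1 + t) = -1 := by ring
    have h5 : 1 - (t : ℂ) ^ 2 + t * t = 1 := by ring
    simpa only [h1, h2, h3, h4, h5, one_pow, mul_one, one_mul, even_two.neg_one_pow] using h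
  · simp only [Polynomial.eval_pow, Polynomial.eval_add, Polynomial.eval_mul, Polynomial.eval_X,
      Polynomial.eval_C, sub_neg_eq_add, hB]
    refine pow_ne_zero _ fun h0 => ?_
    have hz' : ‖z‖ ≤ 1 := by simpa using hz
    have h1 : ‖(t : ℂ) * z‖ = 1 := by
      rw [show (t : ℂ) * z = -1 by linear_combination h0]
      simp
    rw [norm_mul, Complex.norm_real, Real.norm_of_nonneg ht0.le] at h1
    nlinarith

/-- Closed form of `I_k(t) = ∫₀ᵇ (x/(x+1/t))ᵏ p_{1,t}(x) dx` (the case `s = 1`,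
`h = 1`, `b = 4/(1−t)²` of the Fisher limiting spectral distribution). -/
theorem fisher_I_k_closed_form (k : ℕ) (hk : 1 ≤ k) (t : ℝ)
    (ht0 : 0 < t) (ht1 : t < 1) :
    (∫ x in (0:ℝ)..(4 / (1 - t) ^ 2),
        (x / (x + 1 / t)) ^ k *
          ((1 - t) * Real.sqrt ((4 / (1 - t) ^ 2 - x) * x) /
            (2 * Real.pi * x * (1 + t * x)))) =
      -((1 - t) / (2 * t)) -
        (1 / (2 * t)) *
          ∑ j ∈ Finset.Nat.antidiagonalTuple 4 k,
            (-1 : ℝ) ^ ((j 3 : ℤ) - (j 1 : ℤ) + 1) *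
              (Nat.choose (2 * k) (j 0) : ℝ) * (Nat.choose 2 (j 1) : ℝ) *
              ((Nat.factorial (k + j 3) : ℝ) /
                ((Nat.factorial k : ℝ) * (Nat.factorial (j 3) : ℝ))) *
              (1 - t) ^ ((k : ℤ) - (j 0 : ℤ) - (j 3 : ℤ)) *
              (1 + t) ^ ((1 : ℤ) - (j 1 : ℤ) - (k : ℤ) - (j 3 : ℤ)) *
              t ^ ((k : ℤ) + (j 3 : ℤ) - (j 2 : ℤ)) := by
  have htC : (t : ℂ) ≠ 0 := Complex.ofReal_ne_zero.2 ht0.ne'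
  have hsub : 1 - (t : ℂ) ≠ 0 := by exact_mod_cast (sub_pos.2 ht1).ne'
  have hadd : 1 + (t : ℂ) ≠ 0 := by exact_mod_cast (add_pos one_pos ht0).ne'
  have hpi : (π : ℂ) ≠ 0 := Complex.ofReal_ne_zero.2 pi_ne_zero
  have hhalf : ∫ θ in (0 : ℝ)..π, fisherAngularDensity k t θ =
      (∫ θ in (0 : ℝ)..(2 * π), fisherAngularDensity k t θ) / 2 := by
    rw [integral_fisherAngularDensity_eq_two_mul k ht0 ht1]
    ring
  rw [integral_fisher_eq_integral_angular hk ht0 ht1, hhalf]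
  apply Complex.ofReal_injective
  rw [Complex.ofReal_mul, Complex.ofReal_div,
    integral_fisherAngularDensity_eq_circleIntegral k ht0 ht1, circleIntegral_fisher k ht0 ht1]
  push_cast
  rw [← coeff_prod_fisherFactors k htC hsub hadd]
  field_simp
  rw [Complex.I_sq]
  ring
end
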